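/- arXiv:1305.0729 — 2 statements merged into one kernel-verified Lean document; each statement's English description precedes it below -/
import Mathlib

section
/- Let F ∈ M_n(ℤ) be symmetric with every entry of F even (so (x,y) := xᵗFy is divisible by 2 for all x, y ∈ ℤⁿ; the 'odd' case of the paper). Suppose w₁, …, w_m ∈ ℤⁿ satisfy wᵢᵗFwᵢ = −2 for all i and wᵢᵗFw_{i+1} = −4 for 1 ≤ i ≤ m−1. Then the product r_{w₁} ∘ r_{w_m} lies in the subgroup of GL_n(ℚ) generated by the reflections {r_x : x ∈ ℤⁿ, xᵗFx = 4}. -/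
open Matrix

/-- Cast an integer vector to a rational vector. -/
def qv {n : ℕ} (u : Fin n → ℤ) : Fin n → ℚ := fun i => (u i : ℚ)

/-- Cast an integer matrix to a rational matrix. -/
def qm {n : ℕ} (F : Matrix (Fin n) (Fin n) ℤ) : Matrix (Fin n) (Fin n) ℚ :=
  F.map (fun x => (x : ℚ))

/-- The matrix of the reflection `r_v : y ↦ y - (2 (v,y)/(v,v)) v` in the root `v`,
with respect to the bilinear form `(x,y) = xᵗ F y`. -/
def reflMat {n : ℕ} (F : Matrix (Fin n) (Fin n) ℚ) (v : Fin n → ℚ) :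
    Matrix (Fin n) (Fin n) ℚ :=
  1 - (2 / (v ⬝ᵥ F.mulVec v)) • vecMulVec v (Fᵀ.mulVec v)

theorem refl_apply {n : ℕ} (G : Matrix (Fin n) (Fin n) ℚ) (hG : Gᵀ = G) (v : Fin n → ℚ) (c : ℚ)
    (h : v ⬝ᵥ G.mulVec v = c) (y : Fin n → ℚ) :
    reflMat G v *ᵥ y = y - (2 / c * (v ⬝ᵥ G.mulVec y)) • v := by
  unfold reflMat
  rw [h, hG, Matrix.sub_mulVec, Matrix.one_mulVec, Matrix.smul_mulVec, Matrix.vecMulVec_mulVec]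
  have : G *ᵥ v ⬝ᵥ y = v ⬝ᵥ G *ᵥ y := by
    rw [Matrix.dotProduct_mulVec, ← Matrix.mulVec_transpose, hG]
  rw [this]
  ext i
  simp
  ring

theorem refl_sq {n : ℕ} (G : Matrix (Fin n) (Fin n) ℚ) (hG : Gᵀ = G) (v : Fin n → ℚ) (c : ℚ)
    (hc : c ≠ 0) (h : v ⬝ᵥ G.mulVec v = c) : reflMat G v * reflMat G v = 1 := by
  apply Matrix.mulVec_injective
  funext y
  simp only [← Matrix.mulVec_mulVec, refl_apply G hG v c h, Matrix.one_mulVec, Matrix.mulVec_sub,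
    Matrix.mulVec_smul, dotProduct_sub, dotProduct_smul, h, smul_eq_mul]
  ext i
  simp only [Pi.sub_apply, Pi.smul_apply, smul_eq_mul]
  field_simp
  ring

theorem refl_pair {n : ℕ} (G : Matrix (Fin n) (Fin n) ℚ) (hG : Gᵀ = G) (u w : Fin n → ℚ)
    (hu : u ⬝ᵥ G.mulVec u = -2) (hw : w ⬝ᵥ G.mulVec w = -2) (huw : u ⬝ᵥ G.mulVec w = -4)
    (hwu : w ⬝ᵥ G.mulVec u = -4) :
    reflMat G ((3 : ℚ) • u - w) * reflMat G (u - w) = reflMat G u * reflMat G w := by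
  have h1 : ((3 : ℚ) • u - w) ⬝ᵥ G.mulVec ((3 : ℚ) • u - w) = 4 := by
    simp only [Matrix.mulVec_sub, Matrix.mulVec_smul, dotProduct_sub, dotProduct_smul,
      sub_dotProduct, smul_dotProduct, hu, hw, huw, hwu, smul_eq_mul]
    norm_num
  have h2 : (u - w) ⬝ᵥ G.mulVec (u - w) = 4 := by
    simp only [Matrix.mulVec_sub, dotProduct_sub, sub_dotProduct, hu, hw, huw, hwu]
    norm_num
  apply Matrix.mulVec_injective
  funext y
  simp only [← Matrix.mulVec_mulVec, refl_apply G hG _ _ h1, refl_apply G hG _ _ h2,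
    refl_apply G hG _ _ hu, refl_apply G hG _ _ hw, Matrix.mulVec_sub,
    Matrix.mulVec_smul, dotProduct_sub, dotProduct_smul, sub_dotProduct, smul_dotProduct,
    hu, hw, huw, hwu, smul_eq_mul]
  ext i
  simp only [Pi.sub_apply, Pi.smul_apply, smul_eq_mul]
  ring

theorem qv_dot {n : ℕ} (F : Matrix (Fin n) (Fin n) ℤ) (x y : Fin n → ℤ) :
    qv x ⬝ᵥ (qm F).mulVec (qv y) = ((x ⬝ᵥ F.mulVec y : ℤ) : ℚ) := by
  simp [qv, qm, dotProduct, Matrix.mulVec]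

theorem stmt4 (n m : ℕ) (hm : 1 ≤ m)
    (F : Matrix (Fin n) (Fin n) ℤ) (hF : F.IsSymm)
    (heven : ∀ i j, Even (F i j))
    (w : ℕ → Fin n → ℤ)
    (hnorm : ∀ i, i < m → (w i) ⬝ᵥ F.mulVec (w i) = -2)
    (hadj : ∀ i, i + 1 < m → (w i) ⬝ᵥ F.mulVec (w (i + 1)) = -4) :
    ∃ g ∈ Subgroup.closure
        {g : (Matrix (Fin n) (Fin n) ℚ)ˣ | ∃ x : Fin n → ℤ,
          x ⬝ᵥ F.mulVec x = 4 ∧ (g : Matrix (Fin n) (Fin n) ℚ) = reflMat (qm F) (qv x)},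
      (g : Matrix (Fin n) (Fin n) ℚ) =
        reflMat (qm F) (qv (w 0)) * reflMat (qm F) (qv (w (m - 1))) := by
  have hG : (qm F)ᵀ = qm F := by
    ext i j
    simp [qm, hF.apply]
  have hsq : ∀ (x : Fin n → ℤ) (c : ℤ), c ≠ 0 → x ⬝ᵥ F.mulVec x = c →
      reflMat (qm F) (qv x) * reflMat (qm F) (qv x) = 1 := fun x c hc h =>
    refl_sq _ hG _ (c : ℚ) (by exact_mod_cast hc) (by rw [qv_dot, h])
  have key : ∀ k, k < m → ∃ g ∈ Subgroup.closure
        {g : (Matrix (Fin n) (Fin n) ℚ)ˣ | ∃ x : Fin n → ℤ,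
          x ⬝ᵥ F.mulVec x = 4 ∧ (g : Matrix (Fin n) (Fin n) ℚ) = reflMat (qm F) (qv x)},
      (g : Matrix (Fin n) (Fin n) ℚ) =
        reflMat (qm F) (qv (w 0)) * reflMat (qm F) (qv (w k)) := by
    intro k
    induction k with
    | zero =>
      intro h0
      exact ⟨1, Subgroup.one_mem _, by rw [hsq _ _ (by norm_num) (hnorm 0 h0)]; rfl⟩
    | succ k ih =>
      intro hk
      obtain ⟨g, hg, hge⟩ := ih (by omega)
      have hu := hnorm k (by omega)
      have hw := hnorm (k + 1) hk
      have huw := hadj k hk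
      have hwu : w (k + 1) ⬝ᵥ F.mulVec (w k) = -4 := by
        rw [Matrix.dotProduct_mulVec, ← Matrix.mulVec_transpose, hF.eq, dotProduct_comm, huw]
      have h1 : ((3 : ℤ) • w k - w (k + 1)) ⬝ᵥ F.mulVec ((3 : ℤ) • w k - w (k + 1)) = 4 := by
        simp only [Matrix.mulVec_sub, Matrix.mulVec_smul, dotProduct_sub, dotProduct_smul,
          sub_dotProduct, smul_dotProduct, hu, hw, huw, hwu, smul_eq_mul]
        norm_num
      have h2 : (w k - w (k + 1)) ⬝ᵥ F.mulVec (w k - w (k + 1)) = 4 := by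
        simp only [Matrix.mulVec_sub, dotProduct_sub, sub_dotProduct, hu, hw, huw, hwu]
        norm_num
      have s1 := hsq _ _ (by norm_num) h1
      have s2 := hsq _ _ (by norm_num) h2
      refine ⟨g * (⟨_, _, s1, s1⟩ * ⟨_, _, s2, s2⟩), Subgroup.mul_mem _ hg (Subgroup.mul_mem _
        (Subgroup.subset_closure ⟨_, h1, rfl⟩) (Subgroup.subset_closure ⟨_, h2, rfl⟩)), ?_⟩
      have e1 : qv ((3 : ℤ) • w k - w (k + 1)) = (3 : ℚ) • qv (w k) - qv (w (k + 1)) := by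
        ext i; simp [qv]
      have e2 : qv (w k - w (k + 1)) = qv (w k) - qv (w (k + 1)) := by
        ext i; simp [qv]
      have hp := refl_pair (qm F) hG (qv (w k)) (qv (w (k + 1)))
        (by rw [qv_dot, hu]; norm_num) (by rw [qv_dot, hw]; norm_num)
        (by rw [qv_dot, huw]; norm_num) (by rw [qv_dot, hwu]; norm_num)
      simp only [Units.val_mul]
      rw [hge, e1, e2, hp, mul_assoc, ← mul_assoc (reflMat (qm F) (qv (w k))),
        hsq _ _ (by norm_num) hu, one_mul]
  exact key (m - 1) (by omega)
end

section
/- Let n ≥ 3 be odd. Let A ∈ GL_n(ℤ) be the Levelt companion matrix of P(x) = xⁿ + a₁xⁿ⁻¹ + ⋯ + a_{n−1}x + 1 with palindromic coefficients aᵢ = a_{n−i}, and let B ∈ GL_n(ℤ) be the Levelt companion matrix of Q(x) = xⁿ + b₁xⁿ⁻¹ + ⋯ + b_{n−1}x − 1 with bᵢ = (−1)^i for 1 ≤ i ≤ n−1. Set v := (a_{n−1}+b_{n−1}, …, a₁+b₁, 2)ᵗ. Let f ∈ M_n(ℚ) be symmetric with AᵗfA = f, BᵗfB = f, and vᵗfv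 = −2. Then for all 0 ≤ i, j ≤ n−1: (B^i v)ᵗ f (B^j v) equals −2 if i = j; equals −1 − a₁ if |i − j| = 1; and equals −a_k − a_{k−1} if |i − j| = k with 2 ≤ k ≤ n−1. -/
open Matrix

/-- The Levelt companion matrix of the monic polynomial
`xⁿ + c 1 * xⁿ⁻¹ + ⋯ + c (n-1) * x + c n`. -/
def levelt (n : ℕ) (c : ℕ → ℤ) : Matrix (Fin n) (Fin n) ℤ :=
  Matrix.of fun i j =>
    if (j : ℕ) = n - 1 then -c (n - (i : ℕ))
    else if (i : ℕ) = (j : ℕ) + 1 then 1 else 0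

/-- The vector `v = (a_{n-1}+b_{n-1}, a_{n-2}+b_{n-2}, …, a₁+b₁, 2)ᵗ`. -/
def vvec (n : ℕ) (a b : ℕ → ℤ) : Fin n → ℤ :=
  fun i => if (i : ℕ) = n - 1 then 2 else a (n - 1 - (i : ℕ)) + b (n - 1 - (i : ℕ))


lemma levelt_apply (n : ℕ) (hn : 3 ≤ n) (c : ℕ → ℤ) (x : Fin n → ℚ) (i : ℕ) (hi : i < n) :
    (qm (levelt n c)).mulVec x ⟨i, hi⟩ =
      (if i = 0 then 0 else x ⟨i - 1, by omega⟩) - (c (n - i) : ℚ) * x ⟨n - 1, by omega⟩ := by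
  have h : ∀ j : Fin n, (qm (levelt n c)) ⟨i, hi⟩ j * x j =
      (if j = ⟨i - 1, by omega⟩ then (if i = 0 then 0 else x j) else 0) +
      (if j = ⟨n - 1, by omega⟩ then -(c (n - i) : ℚ) * x j else 0) := by
    intro j
    obtain ⟨j, hj⟩ := j
    simp only [qm, levelt, Matrix.map_apply, Matrix.of_apply, Fin.mk.injEq]
    by_cases h1 : j = n - 1
    · have h2 : ¬ (j = i - 1) := by omega
      rw [if_pos h1, if_neg h2, if_pos h1]
      push_cast
      ring
    · rw [if_neg h1, if_neg h1]
      by_cases h3 : i = j + 1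
      · have h4 : j = i - 1 := by omega
        have h5 : i ≠ 0 := by omega
        rw [if_pos h3, if_pos h4, if_neg h5]
        simp
      · rw [if_neg h3]
        by_cases h5 : i = 0
        · simp [h5]
        · have h4 : ¬ (j = i - 1) := by omega
          simp [h4]
  simp only [Matrix.mulVec, dotProduct]
  rw [Finset.sum_congr rfl (fun j _ => h j), Finset.sum_add_distrib,
    Finset.sum_ite_eq', Finset.sum_ite_eq']
  simp
  ring

lemma form_inv {n : ℕ} (f M : Matrix (Fin n) (Fin n) ℚ) (h : Mᵀ * f * M = f)
    (x y : Fin n → ℚ) : M.mulVec x ⬝ᵥ f.mulVec (M.mulVec y) = x ⬝ᵥ f.mulVec y := by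
  conv_rhs => rw [← h]
  rw [← Matrix.mulVec_mulVec, ← Matrix.mulVec_mulVec, Matrix.dotProduct_mulVec x,
    Matrix.vecMul_transpose]

lemma form_pow {n : ℕ} (f M : Matrix (Fin n) (Fin n) ℚ) (h : Mᵀ * f * M = f)
    (j : ℕ) (x y : Fin n → ℚ) :
    (M ^ j).mulVec x ⬝ᵥ f.mulVec ((M ^ j).mulVec y) = x ⬝ᵥ f.mulVec y := by
  induction j with
  | zero => simp
  | succ j ih =>
    rw [pow_succ', ← Matrix.mulVec_mulVec, ← Matrix.mulVec_mulVec, form_inv f M h, ih]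

lemma form_symm {n : ℕ} (f : Matrix (Fin n) (Fin n) ℚ) (h : f.IsSymm)
    (x y : Fin n → ℚ) : x ⬝ᵥ f.mulVec y = y ⬝ᵥ f.mulVec x := by
  rw [Matrix.dotProduct_mulVec, ← Matrix.mulVec_transpose, h.eq, dotProduct_comm]

lemma rel (n : ℕ) (hn : 3 ≤ n) (hodd : Odd n) (a : ℕ → ℤ) (han : a n = 1) (x : Fin n → ℚ) :
    (qm (levelt n (fun k => (-1) ^ k))).mulVec x =
      (qm (levelt n a)).mulVec
        (x - x ⟨n - 1, by omega⟩ • qv (vvec n a (fun k => (-1) ^ k))) := by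
  funext ⟨i, hi⟩
  rw [levelt_apply n hn, levelt_apply n hn]
  simp only [Pi.sub_apply, Pi.smul_apply, smul_eq_mul, qv, vvec]
  by_cases h0 : i = 0
  · subst h0
    simp [han, hodd.neg_one_pow]
    ring
  · have h1 : ¬ (i - 1 = n - 1) := by omega
    have h2 : n - 1 - (i - 1) = n - i := by omega
    simp only [h0, h1, h2, if_false, if_true]
    push_cast
    ring

lemma form_v (n : ℕ) (hn : 3 ≤ n) (hodd : Odd n) (a : ℕ → ℤ)
    (han : a n = 1)
    (f : Matrix (Fin n) (Fin n) ℚ)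
    (hfA : (qm (levelt n a))ᵀ * f * qm (levelt n a) = f)
    (hfB : (qm (levelt n (fun k => (-1) ^ k)))ᵀ * f * qm (levelt n (fun k => (-1) ^ k)) = f)
    (hv : qv (vvec n a (fun k => (-1) ^ k)) ⬝ᵥ
      f.mulVec (qv (vvec n a (fun k => (-1) ^ k))) = -2) (x : Fin n → ℚ) :
    x ⬝ᵥ f.mulVec (qv (vvec n a (fun k => (-1) ^ k))) = - x ⟨n - 1, by omega⟩ := by
  have h := form_inv f _ hfB x (qv (vvec n a (fun k => (-1) ^ k)))
  rw [rel n hn hodd a han x, rel n hn hodd a han (qv _), form_inv f _ hfA] at h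
  have h2 : qv (vvec n a (fun k => (-1) ^ k)) ⟨n - 1, by omega⟩ = 2 := by
    simp [qv, vvec]
  rw [h2] at h
  generalize qv (vvec n a (fun k => (-1) ^ k)) = v at *
  have h3 : v - (2 : ℚ) • v = -v := by
    rw [two_smul]; abel
  rw [h3, Matrix.mulVec_neg, dotProduct_neg, sub_dotProduct, smul_dotProduct, hv,
    smul_eq_mul] at h
  linarith

lemma pow_v (n : ℕ) (hn : 3 ≤ n) (a : ℕ → ℤ) (k : ℕ) :
    ∀ (m : ℕ) (_ : m + (k + 1) < n),
    ((qm (levelt n (fun k => (-1) ^ k)) ^ (k + 1)).mulVec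
      (qv (vvec n a (fun k => (-1) ^ k)))) ⟨n - 1 - m, by omega⟩ =
      (a (m + k + 1) : ℚ) + (-1) ^ m * (if k = 0 then 1 else (a k : ℚ)) := by
  induction k with
  | zero =>
    intro m hm
    rw [pow_one, levelt_apply n hn]
    have h1 : ¬ (n - 1 - m = 0) := by omega
    have h2 : ¬ (n - 1 - m - 1 = n - 1) := by omega
    have h3 : n - 1 - (n - 1 - m - 1) = m + 1 := by omega
    have h4 : n - (n - 1 - m) = m + 1 := by omega
    simp only [qv, vvec, h1, h2, h3, h4, if_false, if_true]
    push_cast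
    ring
  | succ k ih =>
    intro m hm
    rw [pow_succ', ← Matrix.mulVec_mulVec, levelt_apply n hn]
    have h1 : ¬ (n - 1 - m = 0) := by omega
    have h4 : n - (n - 1 - m) = m + 1 := by omega
    have e1 := ih (m + 1) (by omega)
    have e2 := ih 0 (by omega)
    have h5 : n - 1 - (m + 1) = n - 1 - m - 1 := by omega
    simp only [h5] at e1
    simp only [Nat.sub_zero] at e2
    rw [if_neg h1, e1, e2, h4, if_neg (Nat.succ_ne_zero k)]
    have h6 : m + 1 + k + 1 = m + (k + 1) + 1 := by omega
    rw [h6, Nat.zero_add]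
    push_cast
    ring

theorem stmt9 (n : ℕ) (hn : 3 ≤ n) (hodd : Odd n) (a : ℕ → ℤ)
    (han : a n = 1)
    (hpal : ∀ i, 1 ≤ i → i ≤ n - 1 → a i = a (n - i))
    (f : Matrix (Fin n) (Fin n) ℚ) (hsymm : f.IsSymm)
    (hfA : (qm (levelt n a))ᵀ * f * qm (levelt n a) = f)
    (hfB : (qm (levelt n (fun k => (-1) ^ k)))ᵀ * f * qm (levelt n (fun k => (-1) ^ k)) = f)
    (hv : qv (vvec n a (fun k => (-1) ^ k)) ⬝ᵥ
      f.mulVec (qv (vvec n a (fun k => (-1) ^ k))) = -2) :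
    ∀ i j : ℕ, i ≤ n - 1 → j ≤ n - 1 →
      ((i = j →
        ((qm (levelt n (fun k => (-1) ^ k)) ^ i).mulVec (qv (vvec n a (fun k => (-1) ^ k)))) ⬝ᵥ
          f.mulVec ((qm (levelt n (fun k => (-1) ^ k)) ^ j).mulVec
            (qv (vvec n a (fun k => (-1) ^ k)))) = -2) ∧
      (((i : ℤ) - (j : ℤ)).natAbs = 1 →
        ((qm (levelt n (fun k => (-1) ^ k)) ^ i).mulVec (qv (vvec n a (fun k => (-1) ^ k)))) ⬝ᵥ
          f.mulVec ((qm (levelt n (fun k => (-1) ^ k)) ^ j).mulVec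
            (qv (vvec n a (fun k => (-1) ^ k)))) = -1 - (a 1 : ℚ)) ∧
      (∀ k : ℕ, 2 ≤ k → k ≤ n - 1 → ((i : ℤ) - (j : ℤ)).natAbs = k →
        ((qm (levelt n (fun k => (-1) ^ k)) ^ i).mulVec (qv (vvec n a (fun k => (-1) ^ k)))) ⬝ᵥ
          f.mulVec ((qm (levelt n (fun k => (-1) ^ k)) ^ j).mulVec
            (qv (vvec n a (fun k => (-1) ^ k)))) = -(a k : ℚ) - (a (k - 1) : ℚ))) := by
  have key : ∀ i j : ℕ, i ≤ n - 1 → j ≤ i →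
      ((qm (levelt n (fun k => (-1) ^ k)) ^ i).mulVec (qv (vvec n a (fun k => (-1) ^ k)))) ⬝ᵥ
          f.mulVec ((qm (levelt n (fun k => (-1) ^ k)) ^ j).mulVec
            (qv (vvec n a (fun k => (-1) ^ k)))) =
      if i - j = 0 then -2 else if i - j = 1 then -1 - (a 1 : ℚ)
        else -(a (i - j) : ℚ) - (a (i - j - 1) : ℚ) := by
    intro i j hi hj
    obtain ⟨k, rfl⟩ := Nat.exists_eq_add_of_le hj
    rw [pow_add, ← Matrix.mulVec_mulVec, form_pow f _ hfB, Nat.add_sub_cancel_left]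
    rcases k with _ | k
    · simpa using hv
    · rw [form_v n hn hodd a han f hfA hfB hv]
      have e := pow_v n hn a k 0 (by omega)
      simp only [Nat.sub_zero] at e
      rw [e]
      rcases k with _ | k
      · simp
        ring
      · simp
        ring
  have key2 : ∀ i j : ℕ, i ≤ n - 1 → j ≤ n - 1 →
      ((qm (levelt n (fun k => (-1) ^ k)) ^ i).mulVec (qv (vvec n a (fun k => (-1) ^ k)))) ⬝ᵥ
          f.mulVec ((qm (levelt n (fun k => (-1) ^ k)) ^ j).mulVec
            (qv (vvec n a (fun k => (-1) ^ k)))) =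
      if ((i : ℤ) - (j : ℤ)).natAbs = 0 then -2
        else if ((i : ℤ) - (j : ℤ)).natAbs = 1 then -1 - (a 1 : ℚ)
        else -(a ((i : ℤ) - (j : ℤ)).natAbs : ℚ) - (a (((i : ℤ) - (j : ℤ)).natAbs - 1) : ℚ) := by
    intro i j hi hj
    rcases le_total j i with h | h
    · have e : ((i : ℤ) - (j : ℤ)).natAbs = i - j := by omega
      rw [e, key i j hi h]
    · have e : ((i : ℤ) - (j : ℤ)).natAbs = j - i := by omega
      rw [e, form_symm f hsymm, key j i hj h]
  intro i j hi hj
  rw [key2 i j hi hj]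
  refine ⟨?_, ?_, ?_⟩
  · intro h
    simp [h]
  · intro h
    simp [h]
  · intro k h2 hk h
    rw [h, if_neg (by omega), if_neg (by omega)]
end
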